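/- Let t ≥ 1 and L > 0, suppose ‖g_s‖ ≤ L and g_s ≠ 0 for all s = 1,…,t, and run the projected subgradient method with the Nesterov step-size η_s = R/(‖g_s‖√s). Then the weighted average satisfies f((Σ_{s=1}^t η_s x_s)/(Σ_{s=1}^t η_s)) − f(x*) ≤ (2RL + RL·log t) / (4(√(t+1) − 1)). -/

import Mathlib

open scoped RealInnerProductSpace

section ProjectedSubgradient

variable {E : Type*} [NormedAddCommGroup E] [InnerProductSpace ℝ E]

/-- A nearest point `p` of a convex set to `y` is no farther from any point of the set than `y`. -/
theorem Convex.norm_sub_le_of_forall_norm_sub_le {X : Set E} (hX : Convex ℝ X) {p y z : E}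
    (hp : p ∈ X) (hz : z ∈ X) (hmin : ∀ w ∈ X, ‖p - y‖ ≤ ‖w - y‖) :
    ‖p - z‖ ≤ ‖y - z‖ := by
  have : Nonempty X := ⟨⟨p, hp⟩⟩
  have hinf : ‖y - p‖ = ⨅ w : X, ‖y - w‖ := by
    refine le_antisymm (le_ciInf fun w => ?_) ?_
    · simpa only [norm_sub_rev y] using hmin w w.2
    · exact ciInf_le (f := fun w : X => ‖y - w‖)
        ⟨0, by rintro _ ⟨w, rfl⟩; exact norm_nonneg _⟩ ⟨p, hp⟩
  have hinner := (norm_eq_iInf_iff_real_inner_le_zero hX hp).1 hinf z hz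
  have hexp := norm_sub_sq_real (y - p) (z - p)
  rw [sub_sub_sub_cancel_right, norm_sub_rev z p] at hexp
  exact (sq_le_sq₀ (norm_nonneg _) (norm_nonneg _)).1 (by nlinarith [sq_nonneg ‖y - p‖])

/-- The one-step estimate of the projected subgradient method. -/
theorem projectedSubgradient_step {X : Set E} (hX : Convex ℝ X) {f : E → ℝ} {x x' g z : E} {η : ℝ}
    (hη : 0 ≤ η) (hz : z ∈ X) (hx' : x' ∈ X) (hsub : f x + ⟪g, z - x⟫ ≤ f z)
    (hproj : ∀ w ∈ X, ‖x' - (x - η • g)‖ ≤ ‖w - (x - η • g)‖) :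
    2 * (η * (f x - f z)) ≤ ‖x - z‖ ^ 2 - ‖x' - z‖ ^ 2 + (η * ‖g‖) ^ 2 := by
  have hle := pow_le_pow_left₀ (norm_nonneg _)
    (hX.norm_sub_le_of_forall_norm_sub_le hx' hz hproj) 2
  have hexp := norm_sub_sq_real (x - z) (η • g)
  rw [sub_right_comm, inner_smul_right, norm_smul, Real.norm_of_nonneg hη,
    real_inner_comm] at hexp
  rw [← neg_sub x z, inner_neg_right] at hsub
  nlinarith [mul_le_mul_of_nonneg_left hsub hη]

end ProjectedSubgradient

theorem sum_Icc_inv_le_one_add_log (t : ℕ) :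
    ∑ s ∈ Finset.Icc 1 t, (s : ℝ)⁻¹ ≤ 1 + Real.log t := by
  have h := harmonic_le_one_add_log t
  rw [harmonic_eq_sum_Icc] at h
  push_cast at h
  exact h

theorem two_mul_sqrt_succ_sub_one_le_sum_inv_sqrt (t : ℕ) :
    2 * (√((t : ℝ) + 1) - 1) ≤ ∑ s ∈ Finset.Icc 1 t, (√(s : ℝ))⁻¹ := by
  induction t with
  | zero => simp
  | succ k ih =>
    rw [Finset.sum_Icc_succ_top (by lia)]
    push_cast
    set a := √((k : ℝ) + 1)
    set b := √((k : ℝ) + 1 + 1)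
    have ha : 0 < a := Real.sqrt_pos.2 (by positivity)
    have ha2 : a ^ 2 = k + 1 := Real.sq_sqrt (by positivity)
    have hb2 : b ^ 2 = k + 1 + 1 := Real.sq_sqrt (by positivity)
    have hstep : 2 * (b - a) ≤ a⁻¹ := by
      rw [inv_eq_one_div, le_div_iff₀ ha]
      nlinarith [sq_nonneg (b - a)]
    linarith

theorem stmt6 {n : ℕ} (X : Set (EuclideanSpace ℝ (Fin n)))
    (hXne : X.Nonempty) (hXcl : IsClosed X) (hXcv : Convex ℝ X)
    (R : ℝ) (hR : 0 < R)
    (xstar : EuclideanSpace ℝ (Fin n)) (hxstar : xstar ∈ X)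
    (f : EuclideanSpace ℝ (Fin n) → ℝ) (hf : ConvexOn ℝ Set.univ f)
    (hball : X ⊆ Metric.closedBall xstar R)
    (hmin : ∀ z ∈ X, f xstar ≤ f z)
    (x g : ℕ → EuclideanSpace ℝ (Fin n)) (η : ℕ → ℝ)
    (hx1 : x 1 ∈ X)
    (hηpos : ∀ s, 1 ≤ s → 0 < η s)
    (hsub : ∀ s, 1 ≤ s → ∀ z, f (x s) + ⟪g s, z - x s⟫ ≤ f z)
    (hmem : ∀ s, 1 ≤ s → x (s + 1) ∈ X)
    (hproj : ∀ s, 1 ≤ s → ∀ z ∈ X,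
      ‖x (s + 1) - (x s - η s • g s)‖ ≤ ‖z - (x s - η s • g s)‖)
    (t : ℕ) (ht : 1 ≤ t)
    (L : ℝ) (hL : 0 < L)
    (hgne : ∀ s, 1 ≤ s → s ≤ t → g s ≠ 0)
    (hLip : ∀ s, 1 ≤ s → s ≤ t → ‖g s‖ ≤ L)
    (hη : ∀ s, 1 ≤ s → s ≤ t → η s = R / (‖g s‖ * Real.sqrt s)) :
    f ((∑ s ∈ Finset.Icc 1 t, η s)⁻¹ • ∑ s ∈ Finset.Icc 1 t, η s • x s) - f xstar ≤
      (2 * R * L + R * L * Real.log t) / (4 * (Real.sqrt (t + 1) - 1)) := by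
  have hsqrt : ∀ s : ℕ, 1 ≤ s → 0 < √(s : ℝ) := fun s hs =>
    Real.sqrt_pos.2 (by exact_mod_cast hs)
  have hstep : ∀ s ∈ Finset.Icc 1 t, 2 * (η s * (f (x s) - f xstar)) ≤
      ‖x s - xstar‖ ^ 2 - ‖x (s + 1) - xstar‖ ^ 2 + R ^ 2 * (s : ℝ)⁻¹ := by
    intro s hs
    obtain ⟨h1, h2⟩ := Finset.mem_Icc.1 hs
    have hg : 0 < ‖g s‖ := norm_pos_iff.2 (hgne s h1 h2)
    have hηg : (η s * ‖g s‖) ^ 2 = R ^ 2 * (s : ℝ)⁻¹ := by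
      have : η s * ‖g s‖ = R / √(s : ℝ) := by
        rw [hη s h1 h2]
        field_simp
      rw [this, div_pow, Real.sq_sqrt (Nat.cast_nonneg s), div_eq_mul_inv]
    rw [← hηg]
    exact projectedSubgradient_step hXcv (hηpos s h1).le hxstar (hmem s h1) (hsub s h1 xstar)
      (hproj s h1)
  have htel : ∑ s ∈ Finset.Icc 1 t, (‖x s - xstar‖ ^ 2 - ‖x (s + 1) - xstar‖ ^ 2) ≤ R ^ 2 := by
    have hx1R : ‖x 1 - xstar‖ ≤ R := by simpa [dist_eq_norm] using hball hx1
    have hsum := Finset.sum_Ico_sub (fun s => ‖x s - xstar‖ ^ 2) (show 1 ≤ t + 1 by lia)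
    rw [Finset.Ico_add_one_right_eq_Icc] at hsum
    rw [Finset.sum_sub_distrib] at hsum ⊢
    nlinarith [pow_le_pow_left₀ (norm_nonneg _) hx1R 2, sq_nonneg ‖x (t + 1) - xstar‖]
  have hnum : ∑ s ∈ Finset.Icc 1 t, η s * (f (x s) - f xstar) ≤
      R ^ 2 * (2 + Real.log t) / 2 := by
    have h := Finset.sum_le_sum hstep
    rw [← Finset.mul_sum, Finset.sum_add_distrib, ← Finset.mul_sum] at h
    have hlog := mul_le_mul_of_nonneg_left (sum_Icc_inv_le_one_add_log t) (sq_nonneg R)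
    linarith
  have hden : R / L * (2 * (√((t : ℝ) + 1) - 1)) ≤ ∑ s ∈ Finset.Icc 1 t, η s := by
    refine (mul_le_mul_of_nonneg_left (two_mul_sqrt_succ_sub_one_le_sum_inv_sqrt t)
      (by positivity)).trans ?_
    rw [Finset.mul_sum]
    refine Finset.sum_le_sum fun s hs => ?_
    obtain ⟨h1, h2⟩ := Finset.mem_Icc.1 hs
    have hg : 0 < ‖g s‖ := norm_pos_iff.2 (hgne s h1 h2)
    have hs0 := hsqrt s h1
    rw [hη s h1 h2, ← div_eq_mul_inv, div_div]
    gcongr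
    exact hLip s h1 h2
  have hroot : 0 < √((t : ℝ) + 1) - 1 := by
    have : 1 < √((t : ℝ) + 1) := by
      rw [Real.lt_sqrt zero_le_one]
      have : (1 : ℝ) ≤ t := by exact_mod_cast ht
      linarith
    linarith
  have hlow : 0 < R / L * (2 * (√((t : ℝ) + 1) - 1)) := by positivity
  have hS := hlow.trans_le hden
  have hjensen := hf.map_centerMass_le (t := Finset.Icc 1 t) (w := η) (p := x)
    (fun s hs => (hηpos s (Finset.mem_Icc.1 hs).1).le) hS (fun _ _ => Set.mem_univ _)
  simp only [Finset.centerMass, Function.comp_apply, smul_eq_mul] at hjensen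
  calc _ ≤ (∑ s ∈ Finset.Icc 1 t, η s)⁻¹ * ∑ s ∈ Finset.Icc 1 t, η s * f (x s) - f xstar :=
        sub_le_sub_right hjensen _
    _ = (∑ s ∈ Finset.Icc 1 t, η s * (f (x s) - f xstar)) / ∑ s ∈ Finset.Icc 1 t, η s := by
        simp only [mul_sub, Finset.sum_sub_distrib, ← Finset.sum_mul]
        field_simp
    _ ≤ R ^ 2 * (2 + Real.log t) / 2 / (R / L * (2 * (√((t : ℝ) + 1) - 1))) := by
        gcongr
    _ = _ := by
        field_simp
        ring
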